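/- Let 0 < α < 1 and 1 < p < ∞. The Riemann–Liouville fractional integral I_α f(x) = (1/Γ(α)) ∫₀ˣ f(t)/(x-t)^{1-α} dt maps L^p((0,∞)) into L^p((0,∞), x^{-pα} dx), and its operator norm equals Γ(1 - 1/p)/Γ(1 + α - 1/p). -/

import Mathlib

open MeasureTheory Set

lemma lintegral_Ioo_zero_one_rpow_mul_one_sub_rpow {a b : ℝ} (ha : 0 < a) (hb : 0 < b) :
    ∫⁻ s in Ioo (0 : ℝ) 1, ENNReal.ofReal (s ^ (a - 1) * (1 - s) ^ (b - 1)) =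
      ENNReal.ofReal (ProbabilityTheory.beta a b) := by
  have hB := ProbabilityTheory.beta_pos ha hb
  have h := ProbabilityTheory.lintegral_betaPDF_eq_one ha hb
  rw [ProbabilityTheory.lintegral_betaPDF] at h
  calc _ = ∫⁻ s in Ioo (0 : ℝ) 1, ENNReal.ofReal (ProbabilityTheory.beta a b) *
        ENNReal.ofReal (1 / ProbabilityTheory.beta a b * s ^ (a - 1) * (1 - s) ^ (b - 1)) := by
        refine lintegral_congr fun s => ?_
        rw [← ENNReal.ofReal_mul hB.le]
        congr 1
        field_simp
    _ = _ := by rw [lintegral_const_mul _ (by fun_prop), h, mul_one]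

lemma setLIntegral_comp_mul_left_preimage {c : ℝ} (hc : 0 < c) {S : Set ℝ} (hS : MeasurableSet S)
    {F : ℝ → ENNReal} (hF : Measurable F) :
    ENNReal.ofReal c * ∫⁻ x in (c * ·) ⁻¹' S, F (c * x) = ∫⁻ x in S, F x := by
  have hm : Measurable (c * · : ℝ → ℝ) := measurable_const_mul c
  conv_rhs => rw [← Real.smul_map_volume_mul_left hc.ne']
  rw [Measure.restrict_smul, lintegral_smul_measure, setLIntegral_map hS hF hm, abs_of_pos hc,
    smul_eq_mul]

lemma preimage_mul_left_Ioi_zero {c : ℝ} (hc : 0 < c) : (c * ·) ⁻¹' Ioi (0 : ℝ) = Ioi 0 := by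
  ext x; simp [hc]

lemma preimage_mul_left_Ioo_zero_self {c : ℝ} (hc : 0 < c) :
    (c * ·) ⁻¹' Ioo (0 : ℝ) c = Ioo 0 1 := by
  ext x
  simp [div_self hc.ne', hc]

/-- Jensen's inequality for `t ↦ t ^ p`, without normalisation of the measure. -/
lemma lintegral_rpow_le_measure_univ_rpow_mul {Ω : Type*} [MeasurableSpace Ω] (μ : Measure Ω)
    {p : ℝ} (hp : 1 < p) {G : Ω → ENNReal} (hG : AEMeasurable G μ) :
    (∫⁻ s, G s ∂μ) ^ p ≤ μ univ ^ (p - 1) * ∫⁻ s, G s ^ p ∂μ := by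
  have hpq := Real.HolderConjugate.conjExponent hp
  have h := ENNReal.lintegral_mul_le_Lp_mul_Lq μ hpq hG (g := fun _ => 1) aemeasurable_const
  have hp0 : 0 < p := by linarith
  have h2 := ENNReal.rpow_le_rpow h hp0.le
  simp only [Pi.mul_apply, mul_one, ENNReal.one_rpow, lintegral_one] at h2
  rw [ENNReal.mul_rpow_of_nonneg _ _ hp0.le, ← ENNReal.rpow_mul, ← ENNReal.rpow_mul,
    one_div_mul_cancel hp0.ne', ENNReal.rpow_one] at h2
  rw [mul_comm]
  convert h2 using 3
  rw [Real.conjExponent]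
  field_simp

lemma lintegral_Ioi_dilation_average_rpow_le (μ : Measure ℝ) [SFinite μ]
    (hμ : ∀ᵐ s ∂μ, 0 < s) {p : ℝ} (hp : 1 < p) {F : ℝ → ENNReal} (hF : Measurable F) :
    ∫⁻ x in Ioi (0 : ℝ), (∫⁻ s, ENNReal.ofReal (s ^ (1 / p)) * F (x * s) ∂μ) ^ p ≤
      μ univ ^ p * ∫⁻ x in Ioi (0 : ℝ), F x ^ p := by
  have hp0 : 0 < p := by linarith
  have hFp : Measurable fun x => F x ^ p := hF.pow_const p
  calc _ ≤ ∫⁻ x in Ioi (0 : ℝ), μ univ ^ (p - 1) *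
          ∫⁻ s, (ENNReal.ofReal (s ^ (1 / p)) * F (x * s)) ^ p ∂μ := by
        refine lintegral_mono fun x => lintegral_rpow_le_measure_univ_rpow_mul μ hp ?_
        fun_prop
    _ = μ univ ^ (p - 1) * ∫⁻ x in Ioi (0 : ℝ),
          ∫⁻ s, (ENNReal.ofReal (s ^ (1 / p)) * F (x * s)) ^ p ∂μ := by
        refine lintegral_const_mul _ (Measurable.lintegral_prod_right ?_)
        fun_prop
    _ = μ univ ^ (p - 1) * ∫⁻ s, (∫⁻ x in Ioi (0 : ℝ),
          (ENNReal.ofReal (s ^ (1 / p)) * F (x * s)) ^ p) ∂μ := by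
        rw [lintegral_lintegral_swap]
        fun_prop
    _ = μ univ ^ (p - 1) * ∫⁻ _, (∫⁻ x in Ioi (0 : ℝ), F x ^ p) ∂μ := by
        congr 1
        refine lintegral_congr_ae (hμ.mono fun s hs => ?_)
        have hsp : ENNReal.ofReal (s ^ (1 / p)) ^ p = ENNReal.ofReal s := by
          rw [ENNReal.ofReal_rpow_of_nonneg (by positivity) hp0.le, ← Real.rpow_mul hs.le,
            one_div_mul_cancel hp0.ne', Real.rpow_one]
        simp only [ENNReal.mul_rpow_of_nonneg _ _ hp0.le, hsp, mul_comm _ s]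
        rw [lintegral_const_mul _ (by fun_prop)]
        have := setLIntegral_comp_mul_left_preimage hs measurableSet_Ioi (S := Ioi 0) hFp
        rwa [preimage_mul_left_Ioi_zero hs] at this
    _ = _ := by
        rw [lintegral_const, mul_comm _ (μ univ), ← mul_assoc]
        congr 1
        conv_lhs => rw [← ENNReal.rpow_one (μ univ), ← ENNReal.rpow_mul, one_mul]
        rw [← ENNReal.rpow_add_of_nonneg _ _ (by linarith) zero_le_one, sub_add_cancel]

/-- The measure with the beta density `s ^ (-1 / p) * (1 - s) ^ (α - 1)` on `(0, 1)`. -/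
noncomputable def betaKernel (p α : ℝ) : Measure ℝ :=
  (volume.restrict (Ioo 0 1)).withDensity
    fun s => ENNReal.ofReal (s ^ ((1 - 1 / p) - 1) * (1 - s) ^ (α - 1))

instance (p α : ℝ) : SFinite (betaKernel p α) := by
  unfold betaKernel; infer_instance

lemma betaKernel_univ {p α : ℝ} (hp : 1 < p) (hα : 0 < α) :
    betaKernel p α univ = ENNReal.ofReal (ProbabilityTheory.beta (1 - 1 / p) α) := by
  rw [betaKernel, withDensity_apply _ MeasurableSet.univ, Measure.restrict_univ,
    lintegral_Ioo_zero_one_rpow_mul_one_sub_rpow _ hα]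
  rw [sub_pos, div_lt_one] <;> linarith

lemma betaKernel_ae_pos (p α : ℝ) : ∀ᵐ s ∂betaKernel p α, 0 < s := by
  refine (withDensity_absolutelyContinuous _ _).ae_le ?_
  filter_upwards [ae_restrict_mem measurableSet_Ioo] with s hs using hs.1

lemma lintegral_betaKernel {p : ℝ} (α : ℝ) {F : ℝ → ENNReal} (hF : Measurable F) :
    ∫⁻ s, ENNReal.ofReal (s ^ (1 / p)) * F s ∂betaKernel p α =
      ∫⁻ s in Ioo (0 : ℝ) 1, F s * ENNReal.ofReal ((1 - s) ^ (α - 1)) := by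
  rw [betaKernel, lintegral_withDensity_eq_lintegral_mul _ (by fun_prop) (by fun_prop)]
  refine setLIntegral_congr_fun measurableSet_Ioo fun s hs => ?_
  have h1 : 0 < 1 - s := by linarith [hs.2]
  have h0 := hs.1
  simp only [Pi.mul_apply]
  rw [← mul_assoc, ← ENNReal.ofReal_mul (by positivity), mul_comm (F s)]
  congr 2
  rw [mul_right_comm, ← Real.rpow_add h0]
  simp

/-- The dilation form of the Riemann–Liouville integral of a nonnegative function. -/
lemma lintegral_Ioo_mul_sub_rpow {α x : ℝ} (hx : 0 < x) {F : ℝ → ENNReal} (hF : Measurable F) :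
    ∫⁻ t in Ioo 0 x, F t * ENNReal.ofReal ((x - t) ^ (α - 1)) =
      ENNReal.ofReal (x ^ α) *
        ∫⁻ s in Ioo (0 : ℝ) 1, F (x * s) * ENNReal.ofReal ((1 - s) ^ (α - 1)) := by
  rw [← setLIntegral_comp_mul_left_preimage hx measurableSet_Ioo (by fun_prop),
    preimage_mul_left_Ioo_zero_self hx, ← lintegral_const_mul _ (by fun_prop),
    ← lintegral_const_mul _ (by fun_prop)]
  refine setLIntegral_congr_fun measurableSet_Ioo fun s hs => ?_
  have h1 : 0 < 1 - s := by linarith [hs.2]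
  have h : x * (x - x * s) ^ (α - 1) = x ^ α * (1 - s) ^ (α - 1) := by
    rw [← mul_one_sub, Real.mul_rpow hx.le h1.le, ← mul_assoc, Real.rpow_sub_one hx.ne']
    field_simp
  rw [mul_left_comm, ← ENNReal.ofReal_mul hx.le, h, ENNReal.ofReal_mul (by positivity),
    mul_left_comm]

/-- The weighted `p`-th power of the Riemann–Liouville integral is dominated by that of an average
of dilations against the beta kernel. -/
lemma ofReal_riemannLiouville_rpow_le {p α x : ℝ} (hp : 1 < p) (hα : 0 < α) (hx : 0 < x)
    {f : ℝ → ℝ} (hf : Measurable f) :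
    ENNReal.ofReal (|(1 / Real.Gamma α) * ∫ t in Ioo 0 x, f t * (x - t) ^ (α - 1)| ^ p
        * x ^ (-(p * α))) ≤
      ENNReal.ofReal (1 / Real.Gamma α) ^ p *
        (∫⁻ s, ENNReal.ofReal (s ^ (1 / p)) * ENNReal.ofReal |f (x * s)| ∂betaKernel p α) ^ p := by
  have hp0 : 0 < p := by linarith
  have hΓ := Real.Gamma_pos_of_pos hα
  set J := ∫ t in Ioo 0 x, f t * (x - t) ^ (α - 1) with hJ
  have hreal : |(1 / Real.Gamma α) * J| ^ p * x ^ (-(p * α)) =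
      ((1 / Real.Gamma α) * (x ^ (-α) * |J|)) ^ p := by
    rw [abs_mul, abs_of_pos (by positivity), Real.mul_rpow (by positivity) (by positivity),
      Real.mul_rpow (by positivity) (by positivity), Real.mul_rpow (by positivity) (by positivity),
      ← Real.rpow_mul hx.le]
    ring_nf
  have hnorm : ENNReal.ofReal |J| ≤
      ∫⁻ t in Ioo 0 x, ENNReal.ofReal |f t| * ENNReal.ofReal ((x - t) ^ (α - 1)) := by
    rw [← Real.norm_eq_abs, ofReal_norm]
    refine (enorm_integral_le_lintegral_enorm _).trans_eq ?_
    refine setLIntegral_congr_fun measurableSet_Ioo fun t ht => ?_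
    have : 0 < x - t := by linarith [ht.2]
    rw [← ofReal_norm, norm_mul, Real.norm_eq_abs, Real.norm_eq_abs,
      abs_of_pos (Real.rpow_pos_of_pos this _), ENNReal.ofReal_mul (abs_nonneg _)]
  rw [hreal, ← ENNReal.ofReal_rpow_of_nonneg (by positivity) hp0.le,
    ENNReal.ofReal_mul (by positivity), ENNReal.mul_rpow_of_nonneg _ _ hp0.le,
    ENNReal.ofReal_mul (by positivity),
    lintegral_betaKernel α (F := fun s => ENNReal.ofReal |f (x * s)|) (by fun_prop)]
  rw [lintegral_Ioo_mul_sub_rpow hx (by fun_prop)] at hnorm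
  gcongr
  refine (mul_le_mul_right hnorm _).trans_eq ?_
  rw [← mul_assoc, ← ENNReal.ofReal_mul (by positivity), ← Real.rpow_add hx]
  simp

lemma riemannLiouville_integral_rpow {a α x : ℝ} (ha : 0 < a) (hα : 0 < α) (hx : 0 < x) :
    ∫ t in Ioo 0 x, t ^ (a - 1) * (x - t) ^ (α - 1) =
      x ^ α * x ^ (a - 1) * ProbabilityTheory.beta a α := by
  have hB := ProbabilityTheory.beta_pos ha hα
  rw [integral_eq_lintegral_of_nonneg_ae]
  rotate_left
  · filter_upwards [ae_restrict_mem measurableSet_Ioo] with t ht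
    have := ht.1
    have : 0 < x - t := by linarith [ht.2]
    simp only [Pi.zero_apply]
    positivity
  · exact Measurable.aestronglyMeasurable (by fun_prop)
  have h : ∫⁻ t in Ioo 0 x, ENNReal.ofReal (t ^ (a - 1) * (x - t) ^ (α - 1)) =
      ENNReal.ofReal (x ^ α * x ^ (a - 1) * ProbabilityTheory.beta a α) := by
    calc _ = ∫⁻ t in Ioo 0 x, ENNReal.ofReal (t ^ (a - 1)) *
          ENNReal.ofReal ((x - t) ^ (α - 1)) :=
          setLIntegral_congr_fun measurableSet_Ioo fun t ht =>
            ENNReal.ofReal_mul (Real.rpow_nonneg ht.1.le _)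
      _ = ENNReal.ofReal (x ^ α) * ∫⁻ s in Ioo (0 : ℝ) 1, ENNReal.ofReal (x ^ (a - 1)) *
          ENNReal.ofReal (s ^ (a - 1) * (1 - s) ^ (α - 1)) := by
          rw [lintegral_Ioo_mul_sub_rpow hx (F := fun t => ENNReal.ofReal (t ^ (a - 1)))
            (by fun_prop)]
          congr 1
          refine setLIntegral_congr_fun measurableSet_Ioo fun s hs => ?_
          have hs0 := hs.1
          rw [Real.mul_rpow hx.le hs0.le, ENNReal.ofReal_mul (by positivity),
            ENNReal.ofReal_mul (by positivity), mul_assoc]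
      _ = _ := by
          rw [lintegral_const_mul _ (by fun_prop),
            lintegral_Ioo_zero_one_rpow_mul_one_sub_rpow ha hα, ← mul_assoc,
            ← ENNReal.ofReal_mul (by positivity), ← ENNReal.ofReal_mul (by positivity)]
  rw [h, ENNReal.toReal_ofReal (by positivity)]

/-- Testing a Riemann–Liouville bound on the truncated power `t ^ (ε - 1 / p)` on `(0, 1)`. -/
lemma gamma_div_gamma_le_of_riemannLiouville_bound {p α C ε : ℝ} (hp : 1 < p) (hα : 0 < α)
    (hC : 0 ≤ C) (hε : 0 < ε)
    (h : ∀ f : ℝ → ℝ, Measurable f →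
      (∫⁻ x in Ioi (0:ℝ),
          ENNReal.ofReal (|(1 / Real.Gamma α) * ∫ t in Ioo 0 x, f t * (x - t) ^ (α - 1)| ^ p
            * x ^ (-(p * α)))) ^ (1/p)
        ≤ ENNReal.ofReal C * (∫⁻ x in Ioi (0:ℝ), ENNReal.ofReal (|f x| ^ p)) ^ (1/p)) :
    Real.Gamma (1 - 1/p + ε) / Real.Gamma (1 + α - 1/p + ε) ≤ C := by
  have hp0 : 0 < p := by linarith
  have hp1 : 0 < 1 - 1 / p := by rw [sub_pos, div_lt_one] <;> linarith
  set a := 1 - 1 / p + ε with ha_def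
  have ha : 0 < a := by positivity
  have hΓ := Real.Gamma_pos_of_pos hα
  have hB := ProbabilityTheory.beta_pos ha hα
  set K := 1 / Real.Gamma α * ProbabilityTheory.beta a α with hK
  have hK0 : 0 < K := by positivity
  have hKeq : Real.Gamma a / Real.Gamma (1 + α - 1/p + ε) = K := by
    rw [hK, ProbabilityTheory.beta, show 1 + α - 1/p + ε = a + α by rw [ha_def]; ring]
    field_simp
  set f : ℝ → ℝ := (Ioo 0 1).indicator fun t => t ^ (a - 1) with hf
  have hfm : Measurable f := Measurable.indicator (by fun_prop) measurableSet_Ioo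
  have hpow : ∀ x : ℝ, 0 < x → (x ^ (a - 1)) ^ p = x ^ (p * ε - 1) := fun x hx => by
    rw [← Real.rpow_mul hx.le]
    congr 1
    rw [ha_def]
    field_simp
    ring
  set N := ∫⁻ x in Ioo (0 : ℝ) 1, ENNReal.ofReal (x ^ (p * ε - 1)) with hN
  have hNval : N = ENNReal.ofReal (ProbabilityTheory.beta (p * ε) 1) := by
    rw [← lintegral_Ioo_zero_one_rpow_mul_one_sub_rpow (by positivity) one_pos]
    simp [hN]
  have hNpos := ProbabilityTheory.beta_pos (mul_pos hp0 hε) one_pos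
  have hfN : ∫⁻ x in Ioi (0:ℝ), ENNReal.ofReal (|f x| ^ p) = N := by
    have hind : (fun x => ENNReal.ofReal (|f x| ^ p)) =
        (Ioo 0 1).indicator fun x => ENNReal.ofReal (x ^ (p * ε - 1)) := by
      ext x
      by_cases hx : x ∈ Ioo (0 : ℝ) 1
      · rw [hf, indicator_of_mem hx, indicator_of_mem hx,
          abs_of_pos (Real.rpow_pos_of_pos hx.1 _), hpow x hx.1]
      · rw [hf, indicator_of_notMem hx, indicator_of_notMem hx]
        simp [hp0.ne']
    rw [hind, setLIntegral_indicator measurableSet_Ioo,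
      inter_eq_left.mpr Ioo_subset_Ioi_self]
  have hlow : ENNReal.ofReal K ^ p * N ≤ ∫⁻ x in Ioi (0:ℝ),
      ENNReal.ofReal (|(1 / Real.Gamma α) * ∫ t in Ioo 0 x, f t * (x - t) ^ (α - 1)| ^ p
        * x ^ (-(p * α))) := by
    rw [hN, ← lintegral_const_mul _ (by fun_prop)]
    refine le_trans (le_of_eq ?_) (lintegral_mono_set (s := Ioo 0 1) Ioo_subset_Ioi_self)
    refine setLIntegral_congr_fun measurableSet_Ioo fun x hx => ?_
    have hx0 := hx.1
    have hJ : ∫ t in Ioo 0 x, f t * (x - t) ^ (α - 1) =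
        x ^ α * x ^ (a - 1) * ProbabilityTheory.beta a α := by
      rw [← riemannLiouville_integral_rpow ha hα hx0]
      refine setIntegral_congr_fun measurableSet_Ioo fun t ht => ?_
      simp only [hf]
      rw [indicator_of_mem (show t ∈ Ioo (0 : ℝ) 1 from ⟨ht.1, ht.2.trans hx.2⟩)]
    rw [hJ, show 1 / Real.Gamma α * (x ^ α * x ^ (a - 1) * ProbabilityTheory.beta a α) =
      K * x ^ (a - 1) * x ^ α by rw [hK]; ring, abs_of_pos (by positivity),
      Real.mul_rpow (by positivity) (by positivity), Real.mul_rpow (by positivity) (by positivity),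
      hpow x hx0, mul_assoc, ← Real.rpow_mul hx0.le, ← Real.rpow_add hx0,
      ENNReal.ofReal_rpow_of_nonneg hK0.le hp0.le, ← ENNReal.ofReal_mul (by positivity)]
    simp [mul_comm α p]
  have hmain := (ENNReal.rpow_le_rpow hlow (by positivity : 0 ≤ 1 / p)).trans (h f hfm)
  rw [hfN, ENNReal.mul_rpow_of_nonneg _ _ (by positivity), ← ENNReal.rpow_mul,
    mul_one_div_cancel hp0.ne', ENNReal.rpow_one, hNval,
    ENNReal.ofReal_rpow_of_pos hNpos, ← ENNReal.ofReal_mul hK0.le, ← ENNReal.ofReal_mul hC,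
    ENNReal.ofReal_le_ofReal_iff (by positivity)] at hmain
  rw [hKeq]
  exact le_of_mul_le_mul_right hmain (by positivity)

/-- Sharp bound for the Riemann–Liouville fractional integral
`I_α f(x) = (1/Γ(α)) ∫₀ˣ f(t)(x-t)^{α-1} dt` from `L^p((0,∞))` to `L^p(x^{-pα}dx)`:
the operator norm equals `Γ(1-1/p)/Γ(1+α-1/p)`. -/
theorem riemann_liouville_sharp (p α : ℝ) (hp : 1 < p) (hα0 : 0 < α) (hα1 : α < 1) :
    IsLeast {C : ℝ | 0 ≤ C ∧ ∀ f : ℝ → ℝ, Measurable f →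
      (∫⁻ x in Ioi (0:ℝ),
          ENNReal.ofReal (|(1 / Real.Gamma α) * ∫ t in Ioo 0 x, f t * (x - t) ^ (α - 1)| ^ p
            * x ^ (-(p * α)))) ^ (1/p)
        ≤ ENNReal.ofReal C * (∫⁻ x in Ioi (0:ℝ), ENNReal.ofReal (|f x| ^ p)) ^ (1/p)}
      (Real.Gamma (1 - 1/p) / Real.Gamma (1 + α - 1/p)) := by
  have hp0 : 0 < p := by linarith
  have hp1 : 0 < 1 - 1 / p := by rw [sub_pos, div_lt_one] <;> linarith
  have hΓ := Real.Gamma_pos_of_pos hα0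
  have hΓ1 := Real.Gamma_pos_of_pos hp1
  have hΓ2 := Real.Gamma_pos_of_pos (show 0 < 1 + α - 1 / p by linarith)
  refine ⟨⟨by positivity, fun f hf => ?_⟩, fun C ⟨hC, h⟩ => ?_⟩
  · have hB := ProbabilityTheory.beta_pos hp1 hα0
    have hconst : ENNReal.ofReal (1 / Real.Gamma α) * betaKernel p α univ =
        ENNReal.ofReal (Real.Gamma (1 - 1/p) / Real.Gamma (1 + α - 1/p)) := by
      rw [betaKernel_univ hp hα0, ← ENNReal.ofReal_mul (by positivity), ProbabilityTheory.beta,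
        show 1 - 1 / p + α = 1 + α - 1 / p by ring]
      congr 1
      field_simp
    have hF : Measurable fun x => ENNReal.ofReal |f x| := by fun_prop
    have hmono := setLIntegral_mono' (μ := volume) measurableSet_Ioi
      fun x (hx : x ∈ Ioi (0 : ℝ)) => ofReal_riemannLiouville_rpow_le hp hα0 hx hf
    rw [lintegral_const_mul' _ _ (by finiteness)] at hmono
    have hbound := hmono.trans (mul_le_mul_right
      (lintegral_Ioi_dilation_average_rpow_le _ (betaKernel_ae_pos p α) hp hF) _)
    rw [← mul_assoc, ← ENNReal.mul_rpow_of_nonneg _ _ hp0.le, hconst] at hbound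
    simp only [ENNReal.ofReal_rpow_of_nonneg (abs_nonneg _) hp0.le] at hbound
    refine (ENNReal.rpow_le_rpow hbound (by positivity)).trans_eq ?_
    rw [ENNReal.mul_rpow_of_nonneg _ _ (by positivity), ← ENNReal.rpow_mul,
      mul_one_div_cancel hp0.ne', ENNReal.rpow_one]
  · have hcont : ContinuousAt (fun ε : ℝ =>
        Real.Gamma (1 - 1/p + ε) / Real.Gamma (1 + α - 1/p + ε)) 0 := by
      have hΓcont : ∀ b : ℝ, 0 < b → ContinuousAt (fun ε : ℝ => Real.Gamma (b + ε)) 0 :=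
        fun b hb => ContinuousAt.comp' (f := fun ε : ℝ => b + ε)
          (by rw [add_zero]; exact (Real.differentiableAt_Gamma fun m =>
            ((neg_nonpos.mpr m.cast_nonneg).trans_lt hb).ne').continuousAt)
          (by fun_prop)
      exact (hΓcont _ hp1).div (hΓcont _ (by linarith)) (by rw [add_zero]; exact hΓ2.ne')
    have hlim := hcont.tendsto.mono_left (nhdsWithin_le_nhds (s := Ioi 0))
    simp only [add_zero] at hlim
    refine le_of_tendsto hlim ?_
    filter_upwards [self_mem_nhdsWithin] with ε hε
    exact gamma_div_gamma_le_of_riemannLiouville_bound hp hα0 hC hε h
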